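/- Let V be a real or complex Hilbert space, a, b ∈ V, and α, β ≥ 0 real numbers with α ≤ ‖a‖ and β ≤ ‖b‖. Define ã = (α/‖a‖)·a if a ≠ 0 and ã = 0 if a = 0, and likewise b̃ = (β/‖b‖)·b if b ≠ 0 and b̃ = 0 if b = 0. Then ‖ã − b̃‖² ≤ |α − β|² + ‖a − b‖². -/

import Mathlib

open scoped Classical

/-- Rescaling two vectors by real factors `s` and `t` with `s * t ≤ 1` increases their squared
distance by at most the squared difference of the norms `s * ‖a‖` and `t * ‖b‖`. -/
theorem norm_ofReal_smul_sub_sq_le {𝕜 V : Type*} [RCLike 𝕜] [NormedAddCommGroup V]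
    [InnerProductSpace 𝕜 V] (a b : V) {s t : ℝ} (hst : s * t ≤ 1) :
    ‖(s : 𝕜) • a - (t : 𝕜) • b‖ ^ 2 ≤ (s * ‖a‖ - t * ‖b‖) ^ 2 + ‖a - b‖ ^ 2 := by
  have hr : RCLike.re (inner 𝕜 a b) ≤ ‖a‖ * ‖b‖ := re_inner_le_norm a b
  have hinner : RCLike.re (inner 𝕜 ((s : 𝕜) • a) ((t : 𝕜) • b)) =
      s * t * RCLike.re (inner 𝕜 a b) := by
    rw [inner_smul_left, inner_smul_right, RCLike.conj_ofReal, RCLike.re_ofReal_mul,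
      RCLike.re_ofReal_mul, mul_assoc]
  rw [@norm_sub_sq 𝕜, @norm_sub_sq 𝕜 _ _ _ _ a b, hinner, norm_smul, norm_smul,
    RCLike.norm_ofReal, RCLike.norm_ofReal, mul_pow, mul_pow, sq_abs, sq_abs]
  nlinarith [mul_nonneg (sub_nonneg.2 hst) (sub_nonneg.2 hr), sq_nonneg (‖a‖ - ‖b‖)]

/-- If `a, b` are vectors in a Hilbert space and `0 ≤ α ≤ ‖a‖`, `0 ≤ β ≤ ‖b‖`, then the
rescaled vectors `ã = (α/‖a‖)a` and `b̃ = (β/‖b‖)b` (taken to be `0` when `a = 0`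
resp. `b = 0`) satisfy `‖ã - b̃‖² ≤ |α - β|² + ‖a - b‖²`. -/
theorem rescaled_vectors_dist_sq_le {𝕜 V : Type*} [RCLike 𝕜] [NormedAddCommGroup V]
    [InnerProductSpace 𝕜 V] (a b : V) (α β : ℝ)
    (hα0 : 0 ≤ α) (hβ0 : 0 ≤ β) (hα : α ≤ ‖a‖) (hβ : β ≤ ‖b‖) :
    ‖(if a = 0 then (0 : V) else ((α / ‖a‖ : ℝ) : 𝕜) • a) -
        (if b = 0 then (0 : V) else ((β / ‖b‖ : ℝ) : 𝕜) • b)‖ ^ 2 ≤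
      |α - β| ^ 2 + ‖a - b‖ ^ 2 := by
  have hite (c : V) (γ : 𝕜) : (if c = 0 then (0 : V) else γ • c) = γ • c := by
    split_ifs with h <;> simp [h]
  have hscale {γ : ℝ} {c : V} (h0 : 0 ≤ γ) (h : γ ≤ ‖c‖) : γ / ‖c‖ * ‖c‖ = γ :=
    div_mul_cancel_of_imp fun hc ↦ le_antisymm (hc ▸ h) h0
  have hprod : α / ‖a‖ * (β / ‖b‖) ≤ 1 :=
    mul_le_one₀ (div_le_one_of_le₀ hα (norm_nonneg a)) (div_nonneg hβ0 (norm_nonneg b))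
      (div_le_one_of_le₀ hβ (norm_nonneg b))
  rw [hite, hite, sq_abs]
  simpa only [hscale hα0 hα, hscale hβ0 hβ] using
    norm_ofReal_smul_sub_sq_le (𝕜 := 𝕜) a b hprod
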